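/- Let R_p(g) := E[(r(a) − μ̂(x) − ⟨e_a − p(x), g(x,·)⟩)²]. Suppose g* : X×A → ℝ is a bounded measurable minimizer of R_p, i.e., R_p(g*) ≤ R_p(g') for every bounded measurable g'. Then for every bounded measurable g : X×A → ℝ, the excess risk satisfies R_p(g) − R_p(g*) = E_{x∼ν}[Σ_{a∈A} p(a|x) ⟨e_a − p(x), g(x,·) − g*(x,·)⟩²]; in particular this quantity does not depend on the choice of the fixed function μ̂. -/

import Mathlib

open MeasureTheory

/-- The R-loss risk `R_p(g) = E[(r(a) − μ̂(x) − ⟨e_a − p(x), g(x,·)⟩)²]`,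
where the data `(x, a, r)` is given by random variables `ξ, α, ρ` on `(Ω, P)`. -/
noncomputable def Rloss {X A Ω : Type*} [Fintype A] [MeasurableSpace Ω]
    (P : Measure Ω) (p : X → A → ℝ)
    (ξ : Ω → X) (α : Ω → A) (ρ : Ω → A → ℝ) (μhat : X → ℝ) (g : X → A → ℝ) : ℝ :=
  ∫ ω, (ρ ω (α ω) - μhat (ξ ω) -
      (g (ξ ω) (α ω) - ∑ a', p (ξ ω) a' * g (ξ ω) a')) ^ 2 ∂P

theorem aux_meas {X A Ω : Type*} [MeasurableSpace X] [Fintype A] [MeasurableSpace A]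
    [MeasurableSingletonClass A] [MeasurableSpace Ω] (f : X → A → ℝ)
    (hf : ∀ a, Measurable fun x => f x a) (ξ : Ω → X) (α : Ω → A)
    (hξ : Measurable ξ) (hα : Measurable α) : Measurable fun ω => f (ξ ω) (α ω) := by
  have h : Measurable (fun z : X × A => f z.1 z.2) :=
    measurable_from_prod_countable_left (fun a => hf a)
  exact h.comp (hξ.prodMk hα)

theorem aux_sum_bd {A : Type*} [Fintype A] (q : A → ℝ) (h0 : ∀ a, 0 ≤ q a)
    (h1 : ∑ a, q a = 1) (h : A → ℝ) (C : ℝ) (hC : ∀ a, |h a| ≤ C) :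
    |∑ a, q a * h a| ≤ C := by
  calc |∑ a, q a * h a| ≤ ∑ a, |q a * h a| := Finset.abs_sum_le_sum_abs _ _
    _ ≤ ∑ a, q a * C := Finset.sum_le_sum fun a _ => by
        rw [abs_mul, abs_of_nonneg (h0 a)]
        exact mul_le_mul_of_nonneg_left (hC a) (h0 a)
    _ = C := by rw [← Finset.sum_mul, h1, one_mul]

theorem aux_int {Ω : Type*} [MeasurableSpace Ω] (P : Measure Ω) [IsProbabilityMeasure P]
    (f : Ω → ℝ) (hf : Measurable f) (C : ℝ) (hC : ∀ ω, |f ω| ≤ C) : Integrable f P :=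
  Integrable.of_bound hf.aestronglyMeasurable C (Filter.Eventually.of_forall hC)

theorem aux_quad (b c : ℝ) (h : ∀ t : ℝ, 0 ≤ -(2 * t * b) + t ^ 2 * c) : b = 0 := by
  by_contra hb
  have hc : 0 ≤ c := by have := h 1; have := h (-1); linarith
  have h1 := h (b / (c + 1))
  have : -(2 * (b / (c + 1)) * b) + (b / (c + 1)) ^ 2 * c
      = - (b ^ 2 * (c + 2) / (c + 1) ^ 2) := by
    field_simp
    ring
  rw [this] at h1
  have : 0 < b ^ 2 * (c + 2) / (c + 1) ^ 2 := by positivity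
  linarith

theorem rloss_excess_risk_identity
{X : Type*} [MeasurableSpace X] (ν : Measure X) [IsProbabilityMeasure ν]
    {A : Type*} [Fintype A] [Nonempty A]
    [MeasurableSpace A] [MeasurableSingletonClass A]
    -- the probability kernel `p`
    (p : X → A → ℝ)
    (hp0 : ∀ x a, 0 ≤ p x a) (hp1 : ∀ x, ∑ a, p x a = 1)
    (hpm : ∀ a, Measurable fun x => p x a)
    -- the random triple `(x, a, r)` on a probability space `(Ω, P)`
    {Ω : Type*} [MeasurableSpace Ω] (P : Measure Ω) [IsProbabilityMeasure P]
    (ξ : Ω → X) (α : Ω → A) (ρ : Ω → A → ℝ)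
    (hξ : Measurable ξ) (hα : Measurable α) (hρm : ∀ a, Measurable fun ω => ρ ω a)
    (hρ : ∀ ω a, ρ ω a ∈ Set.Icc (0 : ℝ) 1)
    -- `f*(x,a) = E[r(a) | x]`
    (fstar : X → A → ℝ)
    (hfm : ∀ a, Measurable fun x => fstar x a)
    (hfb : ∀ x a, fstar x a ∈ Set.Icc (0 : ℝ) 1)
    (hortho : ∀ ψ : X → A → ℝ, (∀ a, Measurable fun x => ψ x a) →
      (∃ C, ∀ x a, |ψ x a| ≤ C) →
      ∫ ω, (ρ ω (α ω) - fstar (ξ ω) (α ω)) * ψ (ξ ω) (α ω) ∂P = 0)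
    -- `x` has law `ν` and, conditionally on `x`, `a ∼ p(·|x)`
    (hlaw : ∀ φ : X → A → ℝ, (∀ a, Measurable fun x => φ x a) →
      (∃ C, ∀ x a, |φ x a| ≤ C) →
      ∫ ω, φ (ξ ω) (α ω) ∂P = ∫ x, ∑ a, p x a * φ x a ∂ν)
-- the fixed nuisance estimate `μ̂`
    (μhat : X → ℝ) (hμm : Measurable μhat) (hμb : ∃ C, ∀ x, |μhat x| ≤ C)
    -- gstar is a bounded measurable minimizer of the R-loss risk
    (gstar : X → A → ℝ)
    (hgsm : ∀ a, Measurable fun x => gstar x a) (hgsb : ∃ C, ∀ x a, |gstar x a| ≤ C)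
    (hmin : ∀ g' : X → A → ℝ, (∀ a, Measurable fun x => g' x a) →
      (∃ C, ∀ x a, |g' x a| ≤ C) →
      Rloss P p ξ α ρ μhat gstar ≤ Rloss P p ξ α ρ μhat g') :
    ∀ g : X → A → ℝ, (∀ a, Measurable fun x => g x a) → (∃ C, ∀ x a, |g x a| ≤ C) →
      Rloss P p ξ α ρ μhat g - Rloss P p ξ α ρ μhat gstar
        = ∫ x, ∑ a, p x a *
            ((g x a - gstar x a) - ∑ a', p x a' * (g x a' - gstar x a')) ^ 2 ∂ν := by
  intro g hgm ⟨Cg, hCg⟩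
  obtain ⟨Cs, hCs⟩ := hgsb
  obtain ⟨Cm, hCm⟩ := hμb
  set D : X → A → ℝ := fun x a =>
    (g x a - gstar x a) - ∑ a', p x a' * (g x a' - gstar x a') with hD
  have hDm : ∀ a, Measurable fun x => D x a := fun a =>
    ((hgm a).sub (hgsm a)).sub
      (Finset.measurable_fun_sum _ fun a' _ => (hpm a').mul ((hgm a').sub (hgsm a')))
  have hd : ∀ x a, |g x a - gstar x a| ≤ Cg + Cs := fun x a =>
    (abs_sub _ _).trans (add_le_add (hCg x a) (hCs x a))
  have hDb : ∀ x a, |D x a| ≤ (Cg + Cs) + (Cg + Cs) := fun x a =>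
    (abs_sub _ _).trans (add_le_add (hd x a)
      (aux_sum_bd (p x) (hp0 x) (hp1 x) (fun a' => g x a' - gstar x a') _ (hd x)))
  set S : X → A → ℝ := fun x a => gstar x a - ∑ a', p x a' * gstar x a' with hS
  have hSm : ∀ a, Measurable fun x => S x a := fun a =>
    (hgsm a).sub (Finset.measurable_fun_sum _ fun a' _ => (hpm a').mul (hgsm a'))
  have hSb : ∀ x a, |S x a| ≤ Cs + Cs := fun x a =>
    (abs_sub _ _).trans (add_le_add (hCs x a)
      (aux_sum_bd (p x) (hp0 x) (hp1 x) (gstar x) _ (hCs x)))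
  set E : Ω → ℝ := fun ω => D (ξ ω) (α ω) with hE
  set Y : Ω → ℝ := fun ω => ρ ω (α ω) - μhat (ξ ω) - S (ξ ω) (α ω) with hY
  have hEm : Measurable E := aux_meas D hDm ξ α hξ hα
  have hYm : Measurable Y :=
    ((aux_meas ρ hρm id α measurable_id hα).sub (hμm.comp hξ)).sub (aux_meas S hSm ξ α hξ hα)
  have hEb : ∀ ω, |E ω| ≤ (Cg + Cs) + (Cg + Cs) := fun ω => hDb _ _
  have hYb : ∀ ω, |Y ω| ≤ (1 + Cm) + (Cs + Cs) := fun ω => by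
    refine (abs_sub _ _).trans (add_le_add ((abs_sub _ _).trans (add_le_add ?_ (hCm _))) (hSb _ _))
    rw [abs_of_nonneg (hρ ω (α ω)).1]
    exact (hρ ω (α ω)).2
  have hmulint : ∀ (u v : Ω → ℝ) (a b : ℝ), Measurable u → Measurable v →
      (∀ ω, |u ω| ≤ a) → (∀ ω, |v ω| ≤ b) → Integrable (fun ω => u ω * v ω) P := by
    intro u v a b hu hv ha hb
    refine aux_int P _ (hu.mul hv) (a * b) fun ω => ?_
    rw [abs_mul]
    exact mul_le_mul (ha ω) (hb ω) (abs_nonneg _) ((abs_nonneg _).trans (ha ω))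
  have hYY := hmulint Y Y _ _ hYm hYm hYb hYb
  have hYE := hmulint Y E _ _ hYm hEm hYb hEb
  have hEE := hmulint E E _ _ hEm hEm hEb hEb
  have key : ∀ t : ℝ, Rloss P p ξ α ρ μhat (fun x a => gstar x a + t * (g x a - gstar x a))
      = ∫ ω, Y ω * Y ω ∂P + (-(2 * t * ∫ ω, Y ω * E ω ∂P) + t ^ 2 * ∫ ω, E ω * E ω ∂P) := by
    intro t
    have hpt : ∀ ω, (ρ ω (α ω) - μhat (ξ ω) -
        ((gstar (ξ ω) (α ω) + t * (g (ξ ω) (α ω) - gstar (ξ ω) (α ω))) -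
          ∑ a', p (ξ ω) a' * (gstar (ξ ω) a' + t * (g (ξ ω) a' - gstar (ξ ω) a')))) ^ 2
        = Y ω * Y ω + ((-(2 * t)) * (Y ω * E ω) + t ^ 2 * (E ω * E ω)) := by
      intro ω
      have : ∑ a', p (ξ ω) a' * (gstar (ξ ω) a' + t * (g (ξ ω) a' - gstar (ξ ω) a'))
          = ∑ a', p (ξ ω) a' * gstar (ξ ω) a'
            + t * ∑ a', p (ξ ω) a' * (g (ξ ω) a' - gstar (ξ ω) a') := by
        rw [Finset.mul_sum, ← Finset.sum_add_distrib]
        exact Finset.sum_congr rfl fun a' _ => by ring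
      rw [this]
      simp only [hY, hE, hS, hD]
      ring
    unfold Rloss
    simp only [hpt]
    have h2 : Integrable (fun ω => (-(2 * t)) * (Y ω * E ω)) P := hYE.const_mul _
    have h3 : Integrable (fun ω => t ^ 2 * (E ω * E ω)) P := hEE.const_mul _
    have h4 : Integrable (fun ω => (-(2 * t)) * (Y ω * E ω) + t ^ 2 * (E ω * E ω)) P := h2.add h3
    rw [integral_add hYY h4, integral_add h2 h3, integral_const_mul, integral_const_mul]
    ring
  have k0 : Rloss P p ξ α ρ μhat gstar = ∫ ω, Y ω * Y ω ∂P := by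
    have := key 0
    simpa using this
  have hb : ∫ ω, Y ω * E ω ∂P = 0 := by
    refine aux_quad _ (∫ ω, E ω * E ω ∂P) fun t => ?_
    have h1 := hmin (fun x a => gstar x a + t * (g x a - gstar x a))
      (fun a => (hgsm a).add (((hgm a).sub (hgsm a)).const_mul t))
      ⟨Cs + |t| * (Cg + Cs), fun x a => (abs_add_le _ _).trans (add_le_add (hCs x a) (by
        rw [abs_mul]
        exact mul_le_mul_of_nonneg_left (hd x a) (abs_nonneg t)))⟩
    rw [key t, k0] at h1
    linarith
  have k1 : Rloss P p ξ α ρ μhat g = ∫ ω, Y ω * Y ω ∂P + ∫ ω, E ω * E ω ∂P := by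
    have := key 1
    rw [hb] at this
    simpa using this
  rw [k1, k0, add_sub_cancel_left]
  have := hlaw (fun x a => D x a ^ 2) (fun a => (hDm a).pow_const 2)
    ⟨((Cg + Cs) + (Cg + Cs)) ^ 2, fun x a => by
      rw [abs_pow]
      exact pow_le_pow_left₀ (abs_nonneg _) (hDb x a) 2⟩
  rw [← this]
  exact integral_congr_ae (Filter.Eventually.of_forall fun ω => by simp only [hE]; ring)
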